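/- Every transformation of the family in Theorem 1 is a point symmetry of the barotropic vorticity equation on the β-plane: let β, T₀, Y₀ ∈ ℝ, T₁ ∈ ℝ with T₁ ≠ 0, ε ∈ {1, −1}, and let f, g : ℝ → ℝ be smooth. Suppose ψ : ℝ³ → ℝ is smooth and satisfies ζ_t + ψ_x ζ_y − ψ_y ζ_x + β ψ_x = 0 (with ζ = ψ_xx + ψ_yy) at every point of ℝ³. Define ψ̃ : ℝ³ → ℝ by ψ̃(t̃, x̃, ỹ) := (ε / T₁³)·ψ(s, X, Y) − (ε / T₁²)·f′(s)·Y + g(s), where s := (t̃ − T₀)/T₁, X := T₁·(x̃ − f(s)), and Y := ε·T₁·(ỹ − Y₀). Then ψ̃ is smooth and satisfies ζ̃_t + ψ̃_x ζ̃_y − ψ̃_y ζ̃_x + β ψ̃_x = 0 (with ζ̃ = ψ̃_xx + ψ̃_yy) at every point of ℝ³. (Equivalently: the point transformation t̃ = T₁ t + T₀, x̃ = x/T₁ + f(t), ỹ = ε y/T₁ + Y₀, ψ̃ = (ε/T₁³) ψ − (ε/T₁²) f′(t) y + g(t) maps solutions to solutions.) -/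

import Mathlib

noncomputable section

/-- Partial derivative of `F : ℝ³ → ℝ` with respect to the `i`-th coordinate `(t, x, y)`. -/
def pd (i : Fin 3) (F : (Fin 3 → ℝ) → ℝ) (p : Fin 3 → ℝ) : ℝ :=
  fderiv ℝ F p (Pi.single i 1)

/-- The relative vorticity `ζ := ψ_xx + ψ_yy` of a stream function `ψ(t, x, y)`. -/
def vorticity (ψ : (Fin 3 → ℝ) → ℝ) : (Fin 3 → ℝ) → ℝ :=
  fun p => pd 1 (pd 1 ψ) p + pd 2 (pd 2 ψ) p

/-- `ψ` solves the barotropic vorticity equation on the β-plane: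
`ζ_t + ψ_x ζ_y − ψ_y ζ_x + β ψ_x = 0` with `ζ = ψ_xx + ψ_yy`. -/
def IsVorticitySolution (β : ℝ) (ψ : (Fin 3 → ℝ) → ℝ) : Prop :=
  ∀ p, pd 0 (vorticity ψ) p + pd 1 ψ p * pd 2 (vorticity ψ) p
      - pd 2 ψ p * pd 1 (vorticity ψ) p + β * pd 1 ψ p = 0

theorem HasFDerivAt.pd_eq {F : (Fin 3 → ℝ) → ℝ} {F' : (Fin 3 → ℝ) →L[ℝ] ℝ} {p : Fin 3 → ℝ}
    (h : HasFDerivAt F F' p) (i : Fin 3) : pd i F p = F' (Pi.single i 1) := by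
  rw [pd, h.fderiv]

theorem ContDiff.pd {F : (Fin 3 → ℝ) → ℝ} (hF : ContDiff ℝ (⊤ : ℕ∞) F) (i : Fin 3) :
    ContDiff ℝ (⊤ : ℕ∞) (pd i F) :=
  (hF.fderiv_right (m := (⊤ : ℕ∞)) (by simp)).clm_apply contDiff_const

theorem ContDiff.vorticity {F : (Fin 3 → ℝ) → ℝ} (hF : ContDiff ℝ (⊤ : ℕ∞) F) :
    ContDiff ℝ (⊤ : ℕ∞) (vorticity F) :=
  ((hF.pd 1).pd 1).add ((hF.pd 2).pd 2)

theorem pd_add {F G : (Fin 3 → ℝ) → ℝ} (hF : Differentiable ℝ F) (hG : Differentiable ℝ G)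
    (i : Fin 3) : pd i (fun p => F p + G p) = fun p => pd i F p + pd i G p := by
  ext p
  rw [((hF p).hasFDerivAt.fun_add (hG p).hasFDerivAt).pd_eq]
  rfl

theorem pd_const_mul {F : (Fin 3 → ℝ) → ℝ} (hF : Differentiable ℝ F) (c : ℝ) (i : Fin 3) :
    pd i (fun p => c * F p) = fun p => c * pd i F p := by
  ext p
  rw [((hF p).hasFDerivAt.const_mul c).pd_eq]
  rfl

theorem pd_comp_vec {F a b c : (Fin 3 → ℝ) → ℝ} (hF : Differentiable ℝ F)
    (ha : Differentiable ℝ a) (hb : Differentiable ℝ b) (hc : Differentiable ℝ c)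
    (i : Fin 3) (p : Fin 3 → ℝ) :
    pd i (fun q => F ![a q, b q, c q]) p = pd i a p * pd 0 F ![a p, b p, c p]
      + pd i b p * pd 1 F ![a p, b p, c p] + pd i c p * pd 2 F ![a p, b p, c p] := by
  have hΦ : HasFDerivAt (fun q => ![a q, b q, c q])
      (ContinuousLinearMap.pi ![fderiv ℝ a p, fderiv ℝ b p, fderiv ℝ c p]) p := by
    rw [hasFDerivAt_pi']
    intro j
    fin_cases j
    · exact (ha p).hasFDerivAt
    · exact (hb p).hasFDerivAt
    · exact (hc p).hasFDerivAt
  rw [((hF _).hasFDerivAt.comp p hΦ).pd_eq (F := fun q => F ![a q, b q, c q])]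
  rw [ContinuousLinearMap.comp_apply]
  conv_lhs => rw [pi_eq_sum_univ' (ContinuousLinearMap.pi _ _)]
  simp [Fin.sum_univ_three, pd]

/-- A partial derivative is the derivative along the corresponding coordinate line. -/
theorem pd_eq_deriv_update {F : (Fin 3 → ℝ) → ℝ} (hF : Differentiable ℝ F) (i : Fin 3)
    (p : Fin 3 → ℝ) : pd i F p = deriv (fun u => F (Function.update p i u)) (p i) := by
  have h := hasDerivAt_update p i (p i)
  have hF' : HasFDerivAt F (fderiv ℝ F p) (Function.update p i (p i)) := by
    rw [Function.update_eq_self]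
    exact (hF p).hasFDerivAt
  exact (hF'.comp_hasDerivAt (p i) h).deriv.symm

section ChangeOfVariables

variable (T₀ Y₀ T₁ ε : ℝ) (f : ℝ → ℝ)

/-- The old independent variables as functions of the new ones. -/
def oldVariables (p : Fin 3 → ℝ) : Fin 3 → ℝ :=
  ![(p 0 - T₀) / T₁, T₁ * (p 1 - f ((p 0 - T₀) / T₁)), ε * T₁ * (p 2 - Y₀)]

variable {f}

theorem contDiff_oldVariables (hf : ContDiff ℝ (⊤ : ℕ∞) f) :
    ContDiff ℝ (⊤ : ℕ∞) (oldVariables T₀ Y₀ T₁ ε f) := by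
  rw [contDiff_pi]
  intro j
  fin_cases j <;> simp only [oldVariables] <;> simp <;> fun_prop

theorem pd_comp_oldVariables {F : (Fin 3 → ℝ) → ℝ} (hF : Differentiable ℝ F)
    (hf : Differentiable ℝ f) (i : Fin 3) (p : Fin 3 → ℝ) :
    pd i (fun q => F (oldVariables T₀ Y₀ T₁ ε f q)) p =
      deriv (fun u => (Function.update p i u 0 - T₀) / T₁) (p i)
          * pd 0 F (oldVariables T₀ Y₀ T₁ ε f p)
      + deriv (fun u => T₁ * (Function.update p i u 1
            - f ((Function.update p i u 0 - T₀) / T₁))) (p i)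
          * pd 1 F (oldVariables T₀ Y₀ T₁ ε f p)
      + deriv (fun u => ε * T₁ * (Function.update p i u 2 - Y₀)) (p i)
          * pd 2 F (oldVariables T₀ Y₀ T₁ ε f p) := by
  have ha : Differentiable ℝ (fun q : Fin 3 → ℝ => (q 0 - T₀) / T₁) := by fun_prop
  have hb : Differentiable ℝ (fun q : Fin 3 → ℝ => T₁ * (q 1 - f ((q 0 - T₀) / T₁))) := by
    fun_prop
  have hc : Differentiable ℝ (fun q : Fin 3 → ℝ => ε * T₁ * (q 2 - Y₀)) := by fun_prop
  rw [← pd_eq_deriv_update ha, ← pd_eq_deriv_update hb, ← pd_eq_deriv_update hc]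
  exact pd_comp_vec hF ha hb hc i p

theorem pd_zero_comp_oldVariables {F : (Fin 3 → ℝ) → ℝ} (hF : Differentiable ℝ F)
    (hf : Differentiable ℝ f) (hT₁ : T₁ ≠ 0) (p : Fin 3 → ℝ) :
    pd 0 (fun q => F (oldVariables T₀ Y₀ T₁ ε f q)) p =
      1 / T₁ * pd 0 F (oldVariables T₀ Y₀ T₁ ε f p)
      - deriv f ((p 0 - T₀) / T₁) * pd 1 F (oldVariables T₀ Y₀ T₁ ε f p) := by
  have hs : HasDerivAt (fun u : ℝ => (u - T₀) / T₁) (1 / T₁) (p 0) :=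
    ((hasDerivAt_id (p 0)).sub_const T₀).div_const T₁
  have hX : HasDerivAt (fun u : ℝ => T₁ * (p 1 - f ((u - T₀) / T₁)))
      (T₁ * -(deriv f ((p 0 - T₀) / T₁) * (1 / T₁))) (p 0) :=
    (((hf _).hasDerivAt.comp (p 0) hs).const_sub (p 1)).const_mul T₁
  rw [pd_comp_oldVariables T₀ Y₀ T₁ ε hF hf]
  simp only [Function.update_self, ne_eq, Fin.reduceEq, not_false_eq_true,
    Function.update_of_ne, deriv_const, hs.deriv, hX.deriv]
  field_simp
  ring

theorem pd_one_comp_oldVariables {F : (Fin 3 → ℝ) → ℝ} (hF : Differentiable ℝ F)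
    (hf : Differentiable ℝ f) :
    pd 1 (fun q => F (oldVariables T₀ Y₀ T₁ ε f q)) =
      fun p => T₁ * pd 1 F (oldVariables T₀ Y₀ T₁ ε f p) := by
  ext p
  rw [pd_comp_oldVariables T₀ Y₀ T₁ ε hF hf]
  simp

theorem pd_two_comp_oldVariables {F : (Fin 3 → ℝ) → ℝ} (hF : Differentiable ℝ F)
    (hf : Differentiable ℝ f) :
    pd 2 (fun q => F (oldVariables T₀ Y₀ T₁ ε f q)) =
      fun p => ε * T₁ * pd 2 F (oldVariables T₀ Y₀ T₁ ε f p) := by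
  ext p
  rw [pd_comp_oldVariables T₀ Y₀ T₁ ε hF hf]
  simp

end ChangeOfVariables

theorem pd_one_affine {k l : ℝ → ℝ} (hk : Differentiable ℝ k) (hl : Differentiable ℝ l) :
    pd 1 (fun p => k (p 0) * p 2 + l (p 0)) = fun _ => 0 := by
  ext p
  rw [pd_eq_deriv_update (by fun_prop)]
  simp

theorem pd_two_affine {k l : ℝ → ℝ} (hk : Differentiable ℝ k) (hl : Differentiable ℝ l) :
    pd 2 (fun p => k (p 0) * p 2 + l (p 0)) = fun p => k (p 0) := by
  ext p
  rw [pd_eq_deriv_update (by fun_prop)]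
  simp

theorem pd_two_comp_time {k : ℝ → ℝ} (hk : Differentiable ℝ k) :
    pd 2 (fun p => k (p 0)) = fun _ => 0 := by
  ext p
  rw [pd_eq_deriv_update (by fun_prop)]
  simp

/-- Every transformation of the family from Theorem 1, i.e.
`t̃ = T₁t + T₀`, `x̃ = x/T₁ + f(t)`, `ỹ = εy/T₁ + Y₀`,
`ψ̃ = (ε/T₁³)ψ − (ε/T₁²)f′(t)y + g(t)` with `T₁ ≠ 0`, `ε = ±1` and `f, g` smooth,
maps solutions of the barotropic vorticity equation on the β-plane to solutions.
The transformed stream function is expressed in the new variables via the inverse change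
`s = (t̃ − T₀)/T₁`, `X = T₁(x̃ − f(s))`, `Y = εT₁(ỹ − Y₀)`. -/
theorem theorem1_transformations_are_symmetries
    (β T₀ Y₀ T₁ ε : ℝ) (hT₁ : T₁ ≠ 0) (hε : ε = 1 ∨ ε = -1)
    (f g : ℝ → ℝ) (hf : ContDiff ℝ (⊤ : ℕ∞) f) (hg : ContDiff ℝ (⊤ : ℕ∞) g)
    (ψ : (Fin 3 → ℝ) → ℝ) (hψ : ContDiff ℝ (⊤ : ℕ∞) ψ) (hsol : IsVorticitySolution β ψ) :
    ContDiff ℝ (⊤ : ℕ∞) (fun p : Fin 3 → ℝ =>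
      (ε / T₁ ^ 3) * ψ ![(p 0 - T₀) / T₁,
                         T₁ * (p 1 - f ((p 0 - T₀) / T₁)),
                         ε * T₁ * (p 2 - Y₀)]
        - (ε / T₁ ^ 2) * deriv f ((p 0 - T₀) / T₁) * (ε * T₁ * (p 2 - Y₀))
        + g ((p 0 - T₀) / T₁)) ∧
    IsVorticitySolution β (fun p : Fin 3 → ℝ =>
      (ε / T₁ ^ 3) * ψ ![(p 0 - T₀) / T₁,
                         T₁ * (p 1 - f ((p 0 - T₀) / T₁)),
                         ε * T₁ * (p 2 - Y₀)]
        - (ε / T₁ ^ 2) * deriv f ((p 0 - T₀) / T₁) * (ε * T₁ * (p 2 - Y₀))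
        + g ((p 0 - T₀) / T₁)) := by
  have hf' : ContDiff ℝ (⊤ : ℕ∞) (deriv f) := (contDiff_infty_iff_deriv.1 hf).2
  have hε2 : ε ^ 2 = 1 := by rcases hε with rfl | rfl <;> norm_num
  let k : ℝ → ℝ := fun t => -(1 / T₁) * deriv f ((t - T₀) / T₁)
  let l : ℝ → ℝ := fun t => 1 / T₁ * deriv f ((t - T₀) / T₁) * Y₀ + g ((t - T₀) / T₁)
  have hk : ContDiff ℝ (⊤ : ℕ∞) k := by fun_prop
  have hl : ContDiff ℝ (⊤ : ℕ∞) l := by fun_prop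
  have hΦ := contDiff_oldVariables T₀ Y₀ T₁ ε hf
  set Φ := oldVariables T₀ Y₀ T₁ ε f with hΦdef
  have key : (fun p : Fin 3 → ℝ =>
      (ε / T₁ ^ 3) * ψ ![(p 0 - T₀) / T₁,
                         T₁ * (p 1 - f ((p 0 - T₀) / T₁)),
                         ε * T₁ * (p 2 - Y₀)]
        - (ε / T₁ ^ 2) * deriv f ((p 0 - T₀) / T₁) * (ε * T₁ * (p 2 - Y₀))
        + g ((p 0 - T₀) / T₁)) =
      fun p => (ε / T₁ ^ 3) * ψ (Φ p) + (k (p 0) * p 2 + l (p 0)) := by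
    ext p
    simp only [hΦdef, oldVariables, k, l]
    field_simp
    linear_combination (-T₁ ^ 2 * (p 2 - Y₀) * deriv f ((p 0 - T₀) / T₁)) * hε2
  rw [key]
  have dΦ : ∀ {F : (Fin 3 → ℝ) → ℝ}, ContDiff ℝ (⊤ : ℕ∞) F →
      Differentiable ℝ (fun p => F (Φ p)) :=
    fun hF => (hF.comp hΦ).differentiable (by simp)
  have df := hf.differentiable (by simp)
  have dk := hk.differentiable (by simp)
  have dl := hl.differentiable (by simp)
  have d : ∀ {F : (Fin 3 → ℝ) → ℝ}, ContDiff ℝ (⊤ : ℕ∞) F → Differentiable ℝ F :=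
    fun hF => hF.differentiable (by simp)
  refine ⟨by fun_prop, ?_⟩
  set ψ' : (Fin 3 → ℝ) → ℝ :=
    fun p => (ε / T₁ ^ 3) * ψ (Φ p) + (k (p 0) * p 2 + l (p 0)) with hψ'
  have h1 : pd 1 ψ' = fun p => ε / T₁ ^ 2 * pd 1 ψ (Φ p) := by
    rw [hψ', pd_add ((dΦ hψ).const_mul _) (by fun_prop), pd_const_mul (dΦ hψ),
      pd_one_comp_oldVariables T₀ Y₀ T₁ ε (d hψ) df, pd_one_affine dk dl]
    ext p
    field_simp
    ring
  have h2 : pd 2 ψ' = fun p => 1 / T₁ ^ 2 * pd 2 ψ (Φ p) + k (p 0) := by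
    rw [hψ', pd_add ((dΦ hψ).const_mul _) (by fun_prop), pd_const_mul (dΦ hψ),
      pd_two_comp_oldVariables T₀ Y₀ T₁ ε (d hψ) df, pd_two_affine dk dl]
    ext p
    field_simp
    rw [hε2, one_mul]
  have hζ : vorticity ψ' = fun p => ε / T₁ * vorticity ψ (Φ p) := by
    ext p
    rw [vorticity, h1, h2, pd_const_mul (dΦ (hψ.pd 1)),
      pd_add ((dΦ (hψ.pd 2)).const_mul _) (by fun_prop), pd_const_mul (dΦ (hψ.pd 2)),
      pd_one_comp_oldVariables T₀ Y₀ T₁ ε (d (hψ.pd 1)) df,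
      pd_two_comp_oldVariables T₀ Y₀ T₁ ε (d (hψ.pd 2)) df, pd_two_comp_time dk]
    simp only [vorticity]
    field_simp
    ring
  intro p
  have hs := hsol (Φ p)
  have dζ := d hψ.vorticity
  simp only [hζ, h1, h2, pd_const_mul (dΦ hψ.vorticity)]
  rw [pd_zero_comp_oldVariables T₀ Y₀ T₁ ε dζ df hT₁,
    pd_one_comp_oldVariables T₀ Y₀ T₁ ε dζ df, pd_two_comp_oldVariables T₀ Y₀ T₁ ε dζ df]
  simp only [k, ← hΦdef]
  have hmul := congrArg (fun z => ε / T₁ ^ 2 * z) hs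
  simp only [mul_zero] at hmul
  rw [← hmul]
  field_simp
  linear_combination (ε * pd 1 ψ (Φ p) * pd 2 (vorticity ψ) (Φ p)) * hε2

end
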